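/- If the pair predictor p̂₂ is pair-calibrated with some grouping function Φ, then its cheat-corrected epistemic variance is nonnegative: V̂(y|x) = p̂₂(y,y|x) − p̂₁(y|x)² ≥ 0 for all x ∈ 𝒳 and y ∈ 𝒴. -/

import Mathlib

open Finset

open scoped Classical

/-- Conditional expectation of `f(X)` given `X ∈ [x]_Φ`, where `X ∼ μ` on a finite set. -/
noncomputable def groupExp {𝒳 𝒵 : Type*} [Fintype 𝒳] (μ : 𝒳 → ℝ) (Φ : 𝒳 → 𝒵)
    (f : 𝒳 → ℝ) (x : 𝒳) : ℝ :=
  (∑ x' : 𝒳, if Φ x' = Φ x then μ x' * f x' else 0) /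
  (∑ x' : 𝒳, if Φ x' = Φ x then μ x' else 0)

/-- Marginal `p̂₁(y|x) = ∑_{y'} p̂₂(y,y'|x)` of a pair predictor. -/
noncomputable def marginal {𝒳 𝒴 : Type*} [Fintype 𝒴] (p2 : 𝒳 → 𝒴 → 𝒴 → ℝ) (x : 𝒳) (y : 𝒴) : ℝ :=
  ∑ y' : 𝒴, p2 x y y'

/-- Cheat-corrected epistemic variance `V̂(y|x) = p̂₂(y,y|x) − p̂₁(y|x)²`. -/
noncomputable def cheatVar {𝒳 𝒴 : Type*} [Fintype 𝒴] (p2 : 𝒳 → 𝒴 → 𝒴 → ℝ) (x : 𝒳) (y : 𝒴) : ℝ :=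
  p2 x y y - (marginal p2 x y) ^ 2

/-- Cheat-corrected epistemic confidence `C(y|x)`. -/
noncomputable def cheatConf {𝒳 𝒴 : Type*} [Fintype 𝒴] (p2 : 𝒳 → 𝒴 → 𝒴 → ℝ) (x : 𝒳) (y : 𝒴) : ℝ :=
  if 0 < p2 x y y then (marginal p2 x y) ^ 2 / p2 x y y else 0


/-- Jensen for grouped expectations: `E[f]² ≤ E[f²]` on each group. -/
theorem sq_groupExp_le {𝒳 𝒵 : Type*} [Fintype 𝒳] {μ : 𝒳 → ℝ} (hμ : ∀ x, 0 ≤ μ x)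
    (Φ : 𝒳 → 𝒵) (f : 𝒳 → ℝ) (x : 𝒳) :
    groupExp μ Φ f x ^ 2 ≤ groupExp μ Φ (fun x' => f x' * f x') x := by
  unfold groupExp
  simp only [← Finset.sum_filter]
  set s := Finset.univ.filter fun x' => Φ x' = Φ x
  have hs : 0 ≤ ∑ i ∈ s, μ i := Finset.sum_nonneg fun i _ => hμ i
  have hcs : (∑ i ∈ s, μ i * f i) ^ 2 ≤ (∑ i ∈ s, μ i) * ∑ i ∈ s, μ i * (f i * f i) :=
    Finset.sum_sq_le_sum_mul_sum_of_sq_le_mul s (fun i _ => hμ i)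
      (fun i _ => mul_nonneg (hμ i) (mul_self_nonneg _)) fun i _ => le_of_eq (by ring)
  rcases hs.eq_or_lt with h | h
  · simp [← h]
  · rw [div_pow, div_le_div_iff₀ (pow_pos h 2) h]
    nlinarith [mul_le_mul_of_nonneg_right hcs hs]

/-- Grouped expectations commute with finite sums. -/
theorem groupExp_sum {𝒳 𝒵 ι : Type*} [Fintype 𝒳] [Fintype ι] (μ : 𝒳 → ℝ) (Φ : 𝒳 → 𝒵)
    (f : ι → 𝒳 → ℝ) (x : 𝒳) :
    groupExp μ Φ (fun x' => ∑ i, f i x') x = ∑ i, groupExp μ Φ (f i) x := by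
  unfold groupExp
  simp only [← Finset.sum_filter, ← Finset.sum_div, Finset.mul_sum]
  rw [Finset.sum_comm]

/-- The marginal of a pair-calibrated predictor is first-order calibrated. -/
theorem marginal_eq_groupExp {𝒳 𝒴 𝒵 : Type*} [Fintype 𝒳] [Fintype 𝒴] {μ : 𝒳 → ℝ}
    {p : 𝒳 → 𝒴 → ℝ} (hp1 : ∀ x, ∑ y, p x y = 1) {p2 : 𝒳 → 𝒴 → 𝒴 → ℝ} {Φ : 𝒳 → 𝒵}
    (hcal : ∀ x y₁ y₂, p2 x y₁ y₂ = groupExp μ Φ (fun x' => p x' y₁ * p x' y₂) x)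
    (x : 𝒳) (y : 𝒴) : marginal p2 x y = groupExp μ Φ (fun x' => p x' y) x := by
  simp only [marginal, hcal, ← groupExp_sum, ← Finset.mul_sum, hp1, mul_one]

/-- The cheat-corrected epistemic variance of a pair-calibrated pair
predictor is nonnegative. -/
theorem stmt_4 {𝒳 𝒴 𝒵 : Type*} [Fintype 𝒳] [Fintype 𝒴] [Nonempty 𝒳] [Nonempty 𝒴]
    (μ : 𝒳 → ℝ) (hμpos : ∀ x, 0 < μ x) (hμsum : ∑ x, μ x = 1)
    (p : 𝒳 → 𝒴 → ℝ) (hp0 : ∀ x y, 0 ≤ p x y) (hp1 : ∀ x, ∑ y, p x y = 1)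
    (p2 : 𝒳 → 𝒴 → 𝒴 → ℝ)
    (hp20 : ∀ x y₁ y₂, 0 ≤ p2 x y₁ y₂) (hp21 : ∀ x, ∑ y₁, ∑ y₂, p2 x y₁ y₂ = 1)
    (Φ : 𝒳 → 𝒵)
    (hcal : ∀ x y₁ y₂, p2 x y₁ y₂ = groupExp μ Φ (fun x' => p x' y₁ * p x' y₂) x) :
    ∀ x y, 0 ≤ cheatVar p2 x y := by
  intro x y
  rw [cheatVar, marginal_eq_groupExp hp1 hcal, hcal, sub_nonneg]
  exact sq_groupExp_le (fun x' => (hμpos x').le) Φ (fun x' => p x' y) x
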